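/- Let n, m, l, a be positive integers with n ≥ 4, m ≥ 2, l ≥ 2, n > m, n > l satisfying |F_n + F_m + F_l - 2^a| < 2^(a/2). Then |α^n·(1 + α^(m-n) + α^(l-n))/√5 - 2^a| < 2^(a/2 + 1), where α = (1+√5)/2. -/

import Mathlib

open Real goldenRatio in
theorem abs_goldenConj_pow_le_half {k : ℕ} (hk : 2 ≤ k) : |ψ ^ k| ≤ 1 / 2 := by
  have hψ : |ψ| ≤ 1 := abs_le.2 ⟨neg_one_lt_goldenConj.le, goldenConj_neg.le.trans zero_le_one⟩
  have h5 : 2 ≤ √5 := Real.le_sqrt_of_sq_le (by norm_num)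
  calc |ψ ^ k| = |ψ| ^ k := abs_pow ψ k
    _ ≤ |ψ| ^ 2 := pow_le_pow_of_le_one (abs_nonneg ψ) hψ hk
    _ = ψ + 1 := by rw [sq_abs, goldenConj_sq]
    _ ≤ 1 / 2 := by unfold goldenConj; linarith

open Real goldenRatio in
theorem goldenRatio_pow_div_sqrt_five (k : ℕ) : φ ^ k / √5 = Nat.fib k + ψ ^ k / √5 := by
  rw [coe_fib_eq]
  ring

theorem first_linear_form_bound_unnormalized
    (n m l a : ℕ) (hn : 4 ≤ n) (hm : 2 ≤ m) (hl : 2 ≤ l) (ha : 0 < a)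
    (hnm : m < n) (hnl : l < n)
    (h : |(Nat.fib n : ℝ) + Nat.fib m + Nat.fib l - 2 ^ a| < (2 : ℝ) ^ ((a : ℝ) / 2)) :
    |((1 + Real.sqrt 5) / 2) ^ n *
        (1 + ((1 + Real.sqrt 5) / 2) ^ ((m : ℤ) - n) +
          ((1 + Real.sqrt 5) / 2) ^ ((l : ℤ) - n)) / Real.sqrt 5 - 2 ^ a| <
      (2 : ℝ) ^ ((a : ℝ) / 2 + 1) := by
  change |Real.goldenRatio ^ n * (1 + Real.goldenRatio ^ ((m : ℤ) - n) +
    Real.goldenRatio ^ ((l : ℤ) - n)) / Real.sqrt 5 - 2 ^ a| < _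
  have hpow (k : ℕ) : Real.goldenRatio ^ n * Real.goldenRatio ^ ((k : ℤ) - n) =
      Real.goldenRatio ^ k := by
    rw [← zpow_natCast, ← zpow_add₀ Real.goldenRatio_ne_zero, add_sub_cancel, zpow_natCast]
  have h5 : 2 ≤ Real.sqrt 5 := Real.le_sqrt_of_sq_le (by norm_num)
  have hψ {k : ℕ} (hk : 2 ≤ k) : |Real.goldenConj ^ k / Real.sqrt 5| ≤ 1 / 4 := by
    rw [abs_div, abs_of_nonneg (Real.sqrt_nonneg 5), div_le_iff₀ (by linarith)]
    linarith [abs_goldenConj_pow_le_half hk]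
  have hone : (1 : ℝ) ≤ 2 ^ ((a : ℝ) / 2) :=
    Real.one_le_rpow one_le_two (by positivity)
  have htwo : (2 : ℝ) ^ ((a : ℝ) / 2 + 1) = 2 ^ ((a : ℝ) / 2) * 2 := by
    rw [Real.rpow_add two_pos, Real.rpow_one]
  rw [mul_add, mul_add, mul_one, hpow, hpow, add_div, add_div, goldenRatio_pow_div_sqrt_five,
    goldenRatio_pow_div_sqrt_five, goldenRatio_pow_div_sqrt_five, htwo]
  have hn' := abs_le.1 (hψ (show 2 ≤ n by lia))
  have hm' := abs_le.1 (hψ hm)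
  have hl' := abs_le.1 (hψ hl)
  rw [abs_lt] at h ⊢
  constructor <;> linarith
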